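/- There is a constant c > 0 such that every bipartite graph G with m edges satisfies |M(G)| ≥ c·m/(log m)^{12}, where M(G) = {e(H) : H an induced subgraph of G} is the set of sizes of induced subgraphs of G. -/

import Mathlib

/-- set of subset sums of `a` over `D`. -/
def ssums {ι : Type} (a : ι → ℕ) (D : Finset ι) : Finset ℕ :=
  D.powerset.image (fun W => ∑ y ∈ W, a y)

lemma ssums_mono {ι : Type} (a : ι → ℕ) {D D' : Finset ι} (h : D ⊆ D') :
    ssums a D ⊆ ssums a D' :=
  Finset.image_subset_image (Finset.powerset_mono.2 h)

lemma zero_mem_ssums {ι : Type} (a : ι → ℕ) (D : Finset ι) : 0 ∈ ssums a D := by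
  unfold ssums
  exact Finset.mem_image.2 ⟨∅, by simp, by simp⟩

lemma add_mem_ssums {ι : Type} [DecidableEq ι] (a : ι → ℕ) {D D' : Finset ι} {y : ι}
    (hy : y ∉ D) (h : insert y D ⊆ D') {s : ℕ} (hs : s ∈ ssums a D) : s + a y ∈ ssums a D' := by
  unfold ssums at *
  obtain ⟨W, hW, rfl⟩ := Finset.mem_image.1 hs
  rw [Finset.mem_powerset] at hW
  refine Finset.mem_image.2 ⟨insert y W, ?_, ?_⟩
  · rw [Finset.mem_powerset]
    exact (Finset.insert_subset_insert y hW).trans h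
  · rw [Finset.sum_insert (fun hh => hy (hW hh)), add_comm]

lemma dvd_of_mem_ssums {ι : Type} (a : ι → ℕ) {D : Finset ι} {g : ℕ}
    (h : ∀ y ∈ D, g ∣ a y) {s : ℕ} (hs : s ∈ ssums a D) : g ∣ s := by
  obtain ⟨W, hW, rfl⟩ := Finset.mem_image.1 hs
  exact Finset.dvd_sum fun y hy => h y (Finset.mem_powerset.1 hW hy)

/-- small subset with same gcd -/
lemma small_gcd_aux {ι : Type} [DecidableEq ι] (a : ι → ℕ) (R : Finset ι) :
    ∀ (n : ℕ) (F : Finset ι), F ⊆ R → F.gcd a ≠ 0 → F.gcd a ≤ n →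
      ∃ F' ⊆ R, F'.card ≤ F.card + Nat.log 2 (F.gcd a) ∧ F'.gcd a = R.gcd a := by
  intro n
  induction n with
  | zero => intro F _ h0 h1; omega
  | succ n ih =>
    intro F hF h0 hn
    by_cases hall : ∀ y ∈ R, F.gcd a ∣ a y
    · refine ⟨F, hF, by omega, ?_⟩
      exact Nat.dvd_antisymm (Finset.dvd_gcd hall) (Finset.gcd_mono hF)
    · push Not at hall
      obtain ⟨y, hyR, hy⟩ := hall
      have e1 : (insert y F).gcd a = Nat.gcd (a y) (F.gcd a) := by
        rw [Finset.gcd_insert]; rfl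
      have d1 : (insert y F).gcd a ∣ F.gcd a := by rw [e1]; exact Nat.gcd_dvd_right _ _
      have ne1 : (insert y F).gcd a ≠ F.gcd a := by
        intro h
        apply hy
        rw [← h, e1]; exact Nat.gcd_dvd_left _ _
      have n0 : (insert y F).gcd a ≠ 0 := fun h => h0 (by rw [h] at d1; exact Nat.eq_zero_of_zero_dvd d1)
      obtain ⟨q, hq⟩ := d1
      have hq2 : 2 ≤ q := by
        rcases q with _ | _ | q
        · rw [Nat.mul_zero] at hq; exact absurd hq h0
        · rw [Nat.zero_add, Nat.mul_one] at hq; exact absurd hq.symm ne1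
        · omega
      have hle : (insert y F).gcd a * 2 ≤ F.gcd a := by
        rw [hq]; exact Nat.mul_le_mul_left _ hq2
      obtain ⟨F', h1, h2, h3⟩ := ih (insert y F) (Finset.insert_subset hyR hF) n0 (by omega)
      refine ⟨F', h1, ?_, h3⟩
      have hc := Finset.card_insert_le y F
      have hl : Nat.log 2 ((insert y F).gcd a) + 1 ≤ Nat.log 2 (F.gcd a) := by
        rw [← Nat.log_mul_base (by norm_num) n0]
        exact Nat.log_mono_right hle
      omega

lemma small_gcd {ι : Type} [DecidableEq ι] (a : ι → ℕ) (R : Finset ι) (B : ℕ)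
    (hB : ∀ y ∈ R, a y ≤ B) :
    ∃ F ⊆ R, F.card ≤ Nat.log 2 B + 1 ∧ F.gcd a = R.gcd a := by
  by_cases h : ∀ y ∈ R, a y = 0
  · refine ⟨∅, by simp, by simp, ?_⟩
    rw [Finset.gcd_empty, eq_comm, Finset.gcd_eq_zero_iff]; exact h
  · push Not at h
    obtain ⟨y, hy, h0⟩ := h
    have e : ({y} : Finset ι).gcd a = a y := by simp
    obtain ⟨F, h1, h2, h3⟩ := small_gcd_aux a R (a y) {y} (by simpa using hy) (by rw [e]; exact h0)
      (by rw [e])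
    refine ⟨F, h1, ?_, h3⟩
    rw [e] at h2
    have := Nat.log_mono_right (b := 2) (hB y hy)
    simp at h2
    omega

/-- residues property -/
def PP {ι : Type} (a : ι → ℕ) (t : ℕ) (D : Finset ι) (g : ℕ) : Prop :=
  ∀ v' : ℕ, 1 ≤ v' → min (t + 1) v' ≤
    ((ssums a D).image (fun s : ℕ => (s : ZMod (g * v')))).card

lemma PP_zero {ι : Type} (a : ι → ℕ) (g : ℕ) : PP a 0 ∅ g := by
  intro v' hv
  have : 0 < ((ssums a ∅).image (fun s : ℕ => (s : ZMod (g * v')))).card := by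
    rw [Finset.card_pos]
    exact ⟨_, Finset.mem_image_of_mem _ (zero_mem_ssums a ∅)⟩
  omega

lemma PP_step {ι : Type} [DecidableEq ι] (a : ι → ℕ) (t : ℕ) (D F : Finset ι) (g : ℕ) (hg : 1 ≤ g)
    (hF : F.gcd a = g) (hdis : Disjoint D F) (h : PP a t D g) : PP a (t + 1) (D ∪ F) g := by
  intro v' hv
  have hpos : 0 < g * v' := Nat.mul_pos hg hv
  have : NeZero (g * v') := ⟨hpos.ne'⟩
  set c : ℕ → ZMod (g * v') := fun s => (s : ZMod (g * v')) with hc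
  set S := (ssums a D).image c with hS
  have h1 : min (t + 1) v' ≤ S.card := h v' hv
  have hmono : S ⊆ (ssums a (D ∪ F)).image c :=
    Finset.image_subset_image (ssums_mono a Finset.subset_union_left)
  by_cases hbig : min (t + 1 + 1) v' ≤ S.card
  · exact hbig.trans (Finset.card_le_card hmono)
  by_cases hinv : ∀ f ∈ F, ∀ s ∈ S, s + c (a f) ∈ S
  · exfalso
    -- stabilizer
    have key : ∀ n : ℕ, (∀ s ∈ S, s + c n ∈ S) → ∀ s ∈ S, s - c n ∈ S := by
      intro n hn s hs
      have himg : S.image (fun x => x + c n) = S := by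
        apply Finset.eq_of_subset_of_card_le
        · intro x hx
          obtain ⟨u, hu, rfl⟩ := Finset.mem_image.1 hx
          exact hn u hu
        · rw [Finset.card_image_of_injective _ (add_left_injective _)]
      rw [← himg] at hs
      obtain ⟨u, hu, rfl⟩ := Finset.mem_image.1 hs
      simpa using hu
    let H : AddSubgroup ℤ :=
      { carrier := {n | (∀ s ∈ S, s + (n : ZMod (g * v')) ∈ S) ∧ (∀ s ∈ S, s - (n : ZMod (g * v')) ∈ S)}
        zero_mem' := by simp
        add_mem' := by
          rintro x y ⟨hx1, hx2⟩ ⟨hy1, hy2⟩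
          refine ⟨fun s hs => ?_, fun s hs => ?_⟩
          · have := hy1 _ (hx1 s hs)
            push_cast; rwa [← add_assoc]
          · have := hy2 _ (hx2 s hs)
            push_cast; rwa [← sub_sub]
        neg_mem' := by
          rintro x ⟨hx1, hx2⟩
          refine ⟨fun s hs => ?_, fun s hs => ?_⟩
          · push_cast; rw [← sub_eq_add_neg]; exact hx2 s hs
          · push_cast; rw [sub_neg_eq_add]; exact hx1 s hs }
    have hHf : ∀ f ∈ F, ((a f : ℕ) : ℤ) ∈ H := by
      intro f hf
      refine ⟨fun s hs => ?_, fun s hs => ?_⟩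
      · have := hinv f hf s hs
        simpa [hc] using this
      · have := key (a f) (hinv f hf) s hs
        simpa [hc] using this
    obtain ⟨n0, hn0⟩ := Int.subgroup_cyclic H
    have hd : n0.natAbs ∣ g := by
      rw [← hF]
      apply Finset.dvd_gcd
      intro f hf
      have := hHf f hf
      rw [hn0, AddSubgroup.mem_closure_singleton] at this
      obtain ⟨k, hk⟩ := this
      rw [← Int.natCast_dvd_natCast, Int.natAbs_dvd]
      exact ⟨k, by rw [← hk]; simp [mul_comm]⟩
    have hgH : ((g : ℕ) : ℤ) ∈ H := by
      rw [hn0, AddSubgroup.mem_closure_singleton]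
      have : n0 ∣ (g : ℤ) := by rwa [← Int.natAbs_dvd, Int.natCast_dvd_natCast]
      obtain ⟨k, hk⟩ := this
      exact ⟨k, by rw [hk]; simp [mul_comm]⟩
    have hg1 : ∀ s ∈ S, s + c g ∈ S := by
      intro s hs
      have := hgH.1 s hs
      simpa [hc] using this
    have h0S : c 0 ∈ S := Finset.mem_image_of_mem _ (zero_mem_ssums a D)
    have hmul : ∀ i : ℕ, c (g * i) ∈ S := by
      intro i
      induction i with
      | zero => simpa using h0S
      | succ i ih =>
        have := hg1 _ ih
        have e : c (g * (i + 1)) = c (g * i) + c g := by simp [hc]; ring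
        rw [e]; exact this
    have hcard : v' ≤ S.card := by
      have : ((Finset.range v').image (fun i => c (g * i))).card = v' := by
        rw [Finset.card_image_of_injOn, Finset.card_range]
        intro i hi j hj hij
        simp only [Finset.coe_range, Set.mem_Iio] at hi hj
        simp only [hc] at hij
        rw [ZMod.natCast_eq_natCast_iff'] at hij
        rw [Nat.mod_eq_of_lt (Nat.mul_lt_mul_of_pos_left hi hg),
          Nat.mod_eq_of_lt (Nat.mul_lt_mul_of_pos_left hj hg)] at hij
        exact Nat.eq_of_mul_eq_mul_left hg hij
      refine this.symm.le.trans (Finset.card_le_card ?_)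
      intro x hx
      obtain ⟨i, _, rfl⟩ := Finset.mem_image.1 hx
      exact hmul i
    omega
  · push Not at hinv
    obtain ⟨f, hf, s, hs, hns⟩ := hinv
    have : insert (s + c (a f)) S ⊆ (ssums a (D ∪ F)).image c := by
      refine Finset.insert_subset ?_ hmono
      obtain ⟨u, hu, rfl⟩ := Finset.mem_image.1 hs
      refine Finset.mem_image.2 ⟨u + a f, ?_, by simp [hc]⟩
      refine add_mem_ssums a (Finset.disjoint_right.1 hdis hf) ?_ hu
      exact Finset.insert_subset (Finset.mem_union_right _ hf) Finset.subset_union_left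
    have := Finset.card_le_card this
    rw [Finset.card_insert_of_notMem hns] at this
    have e : min (t + 1 + 1) v' ≤ S.card + 1 := by omega
    exact e.trans this

lemma grow (S : Finset ℕ) (v : ℕ) (hv : 1 ≤ v) :
    S.card + (S.image (fun s : ℕ => (s : ZMod v))).card ≤ (S ∪ S.image (fun s => s + v)).card := by
  have h1 : (S ∪ S.image (fun s => s + v)).card = S.card + ((S.image (fun s => s + v)) \ S).card := by
    rw [← Finset.union_sdiff_self_eq_union, Finset.card_union_of_disjoint Finset.disjoint_sdiff]
  rw [h1]
  apply Nat.add_le_add_left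
  have : S.image (fun s : ℕ => (s : ZMod v)) ⊆
      ((S.image (fun s => s + v)) \ S).image (fun s : ℕ => (s : ZMod v)) := by
    intro r hr
    obtain ⟨s, hs, rfl⟩ := Finset.mem_image.1 hr
    have hex : ∃ j : ℕ, s + j * v ∉ S := by
      by_contra hcon
      push Not at hcon
      have hinj : Function.Injective (fun j : ℕ => s + j * v) := by
        intro i j hij
        simp only at hij
        exact Nat.eq_of_mul_eq_mul_right hv (by omega)
      exact (Set.infinite_range_of_injective hinj) (S.finite_toSet.subset (by
        rintro _ ⟨j, rfl⟩; exact hcon j))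
    classical
    have hj := Nat.find_spec hex
    have hmin := fun i => Nat.find_min (m := i) hex
    set j := Nat.find hex with hjdef
    have hj0 : j ≠ 0 := by
      intro h; rw [h] at hj; simp at hj; exact hj hs
    obtain ⟨i, hi⟩ := Nat.exists_eq_succ_of_ne_zero hj0
    have h2 := hmin i (by omega)
    push Not at h2
    refine Finset.mem_image.2 ⟨s + j * v, ?_, by simp⟩
    rw [Finset.mem_sdiff]
    refine ⟨Finset.mem_image.2 ⟨_, h2, ?_⟩, hj⟩
    rw [hi]; simp [Nat.succ_mul, add_assoc]
  exact (Finset.card_le_card this).trans Finset.card_image_le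

lemma grow_all {ι : Type} [DecidableEq ι] (a : ι → ℕ) (B g : ℕ) (hg : 1 ≤ g) (D : Finset ι)
    (hP : PP a B D g) (Q : Finset ι) (hdis : Disjoint D Q) (hQ : ∀ y ∈ Q, g ∣ a y ∧ a y ≤ B) :
    ∑ y ∈ Q, a y ≤ g * (ssums a (D ∪ Q)).card := by
  induction Q using Finset.induction_on with
  | empty => simp
  | insert y Q hy ih =>
    rw [Finset.disjoint_insert_right] at hdis
    have ih' := ih hdis.2 (fun z hz => hQ z (Finset.mem_insert_of_mem hz))
    obtain ⟨⟨v', hv'⟩, hle⟩ := hQ y (Finset.mem_insert_self _ _)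
    rw [Finset.sum_insert hy]
    have hsub : D ∪ Q ⊆ D ∪ insert y Q := Finset.union_subset_union_right (Finset.subset_insert _ _)
    rcases Nat.eq_zero_or_pos v' with h0 | hpos
    · rw [hv', h0]
      simp only [mul_zero, zero_add]
      exact ih'.trans (Nat.mul_le_mul_left _ (Finset.card_le_card (ssums_mono a hsub)))
    · have hp := hP v' hpos
      have hgv : 1 ≤ g * v' := Nat.mul_pos hg hpos
      have hgr := grow (ssums a (D ∪ Q)) (g * v') hgv
      have hle2 : ((ssums a D).image (fun s : ℕ => (s : ZMod (g * v')))).card ≤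
          ((ssums a (D ∪ Q)).image (fun s : ℕ => (s : ZMod (g * v')))).card :=
        Finset.card_le_card (Finset.image_subset_image (ssums_mono a Finset.subset_union_left))
      have hsub2 : ssums a (D ∪ Q) ∪ (ssums a (D ∪ Q)).image (fun s => s + g * v') ⊆
          ssums a (D ∪ insert y Q) := by
        refine Finset.union_subset (ssums_mono a hsub) ?_
        intro x hx
        obtain ⟨s, hs, rfl⟩ := Finset.mem_image.1 hx
        rw [← hv']
        refine add_mem_ssums a (by simp [hy, hdis.1]) ?_ hs
        intro z hz
        simp only [Finset.mem_insert, Finset.mem_union] at *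
        tauto
      have hc := Finset.card_le_card hsub2
      have hvB : v' ≤ B := by
        calc v' ≤ g * v' := Nat.le_mul_of_pos_left _ hg
          _ ≤ B := by rw [← hv']; exact hle
      have hmin : min (B + 1) v' = v' := by omega
      rw [hmin] at hp
      have : (ssums a (D ∪ Q)).card + v' ≤ (ssums a (D ∪ insert y Q)).card := by omega
      calc a y + ∑ z ∈ Q, a z ≤ g * v' + g * (ssums a (D ∪ Q)).card := by rw [hv']; omega
        _ = g * ((ssums a (D ∪ Q)).card + v') := by ring
        _ ≤ _ := Nat.mul_le_mul_left _ this

lemma inner {ι : Type} [DecidableEq ι] (a : ι → ℕ) (B g : ℕ) (hg : 1 ≤ g) (R : Finset ι)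
    (hB : ∀ y ∈ R, a y ≤ B) (_hR : R.gcd a = g) (t : ℕ) :
    (∃ D ⊆ R, D.card ≤ t * (Nat.log 2 B + 1) ∧ PP a t D g) ∨
    (∃ R' ⊆ R, (R \ R').card ≤ t * (Nat.log 2 B + 1) ∧ R'.gcd a ≠ g) := by
  induction t with
  | zero => exact Or.inl ⟨∅, by simp, by simp, PP_zero a g⟩
  | succ t ih =>
    rcases ih with ⟨D, hD, hc, hP⟩ | ⟨R', h1, h2, h3⟩
    · by_cases hgc : (R \ D).gcd a = g
      · obtain ⟨F, hF, hFc, hFg⟩ := small_gcd a (R \ D) B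
          (fun y hy => hB y (Finset.sdiff_subset hy))
        left
        refine ⟨D ∪ F, Finset.union_subset hD (hF.trans Finset.sdiff_subset), ?_, ?_⟩
        · have := Finset.card_union_le D F
          rw [Nat.succ_mul]; omega
        · exact PP_step a t D F g hg (hFg.trans hgc)
            (Finset.disjoint_of_subset_right hF Finset.disjoint_sdiff) hP
      · right
        refine ⟨R \ D, Finset.sdiff_subset, ?_, hgc⟩
        rw [Finset.sdiff_sdiff_eq_self hD, Nat.succ_mul]; omega
    · right
      exact ⟨R', h1, by rw [Nat.succ_mul]; omega, h3⟩

lemma outer {ι : Type} [DecidableEq ι] (a : ι → ℕ) (B : ℕ) (k : ℕ) :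
    ∀ R : Finset ι, (∀ y ∈ R, a y ≤ B) → (R.gcd a = 0 ∨ B < R.gcd a * 2 ^ k) →
    ∃ g ≥ 1, ∃ R' ⊆ R, (R \ R').card ≤ k * (B * (Nat.log 2 B + 1)) ∧ (∀ y ∈ R', g ∣ a y) ∧
      ∃ T ⊆ ssums a R, (∀ s ∈ T, g ∣ s) ∧ ∑ y ∈ R', a y ≤ g * T.card := by
  have hzero : ∀ (k : ℕ) (R : Finset ι), R.gcd a = 0 →
    ∃ g ≥ 1, ∃ R' ⊆ R, (R \ R').card ≤ k * (B * (Nat.log 2 B + 1)) ∧ (∀ y ∈ R', g ∣ a y) ∧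
      ∃ T ⊆ ssums a R, (∀ s ∈ T, g ∣ s) ∧ ∑ y ∈ R', a y ≤ g * T.card := by
    intro k R h0
    rw [Finset.gcd_eq_zero_iff] at h0
    refine ⟨1, le_rfl, R, subset_rfl, by simp, by simp, ∅, by simp, by simp, ?_⟩
    rw [Finset.sum_eq_zero h0]; simp
  induction k with
  | zero =>
    intro R hB h
    by_cases h0 : R.gcd a = 0
    · exact hzero 0 R h0
    · exfalso
      apply h0
      rw [Finset.gcd_eq_zero_iff]
      intro y hy
      have hlt : B < R.gcd a := by simpa [h0] using h
      exact Nat.eq_zero_of_dvd_of_lt (Finset.gcd_dvd hy) ((hB y hy).trans_lt hlt)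
  | succ k ih =>
    intro R hB h
    by_cases h0 : R.gcd a = 0
    · exact hzero _ R h0
    have hg : 1 ≤ R.gcd a := Nat.one_le_iff_ne_zero.2 h0
    have hlt : B < R.gcd a * 2 ^ (k + 1) := by simpa [h0] using h
    rcases inner a B (R.gcd a) hg R hB rfl B with ⟨D, hD, hc, hP⟩ | ⟨R', h1, h2, h3⟩
    · refine ⟨R.gcd a, hg, R \ D, Finset.sdiff_subset, ?_, ?_, ssums a R, subset_rfl, ?_, ?_⟩
      · rw [Finset.sdiff_sdiff_eq_self hD, Nat.succ_mul]; omega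
      · intro y hy; exact Finset.gcd_dvd (Finset.sdiff_subset hy)
      · intro s hs; exact dvd_of_mem_ssums a (fun y hy => Finset.gcd_dvd hy) hs
      · have := grow_all a B (R.gcd a) hg D hP (R \ D) Finset.disjoint_sdiff
          (fun y hy => ⟨Finset.gcd_dvd (Finset.sdiff_subset hy), hB y (Finset.sdiff_subset hy)⟩)
        rwa [Finset.union_sdiff_of_subset hD] at this
    · have hd : R.gcd a ∣ R'.gcd a := Finset.gcd_mono h1
      have hh : R'.gcd a = 0 ∨ B < R'.gcd a * 2 ^ k := by
        obtain ⟨q, hq⟩ := hd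
        rcases q with _ | _ | q
        · left; simpa using hq
        · exfalso; apply h3; simpa using hq
        · right
          calc B < R.gcd a * 2 ^ (k + 1) := hlt
            _ = R.gcd a * 2 * 2 ^ k := by ring
            _ ≤ R.gcd a * (q + 1 + 1) * 2 ^ k :=
              Nat.mul_le_mul_right _ (Nat.mul_le_mul_left _ (by omega))
            _ = _ := by rw [hq]
      obtain ⟨g, hg1, R'', hs, hcard, hdv, T, hT, hT2, hT3⟩ := ih R' (fun y hy => hB y (h1 hy)) hh
      refine ⟨g, hg1, R'', hs.trans h1, ?_, hdv, T, hT.trans (ssums_mono a h1), hT2, hT3⟩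
      have : R \ R'' ⊆ (R \ R') ∪ (R' \ R'') := by
        intro z hz
        simp only [Finset.mem_sdiff, Finset.mem_union] at *
        tauto
      have h5 := (Finset.card_le_card this).trans (Finset.card_union_le _ _)
      rw [Nat.succ_mul]; omega

lemma key_lemma {ι : Type} [DecidableEq ι] (a : ι → ℕ) (B : ℕ) (R : Finset ι)
    (hB : ∀ y ∈ R, a y ≤ B) :
    ∃ g ≥ 1, ∃ R' ⊆ R, (R \ R').card ≤ (Nat.log 2 B + 1) * (B * (Nat.log 2 B + 1)) ∧
      (∀ y ∈ R', g ∣ a y) ∧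
      ∃ T ⊆ ssums a R, (∀ s ∈ T, g ∣ s) ∧ ∑ y ∈ R', a y ≤ g * T.card := by
  apply outer a B (Nat.log 2 B + 1) R hB
  by_cases h0 : R.gcd a = 0
  · exact Or.inl h0
  · right
    calc B < 2 ^ (Nat.log 2 B + 1) := Nat.lt_pow_succ_log_self (by norm_num) B
      _ ≤ R.gcd a * 2 ^ (Nat.log 2 B + 1) := Nat.le_mul_of_pos_left _ (Nat.pos_of_ne_zero h0)

/-- weights -/
noncomputable def wt (k u : ℕ) : ℝ :=
  (u.factorial : ℝ) * ((k - u).factorial : ℝ) / ((k + 1).factorial : ℝ)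

lemma wt_nonneg (k u : ℕ) : 0 ≤ wt k u := by unfold wt; positivity

lemma wt_split (k u : ℕ) (h : u ≤ k) : wt (k + 1) u + wt (k + 1) (u + 1) = wt k u := by
  unfold wt
  obtain ⟨j, rfl⟩ := Nat.exists_eq_add_of_le h
  have e1 : u + j + 1 - u = j + 1 := by omega
  have e2 : u + j + 1 - (u + 1) = j := by omega
  have e3 : u + j - u = j := by omega
  rw [e1, e2, e3]
  rw [Nat.factorial_succ (u + j + 1), Nat.factorial_succ j, Nat.factorial_succ u]
  have : ((u + j + 1).factorial : ℝ) ≠ 0 := by positivity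
  push_cast
  field_simp
  ring

lemma wt_base {X : Type} (N : Finset X) (φ : ℕ → ℝ) :
    ∑ U ∈ N.powerset, wt N.card U.card * φ U.card =
      (∑ z ∈ Finset.range (N.card + 1), φ z) / (N.card + 1) := by
  rw [Finset.sum_powerset_apply_card (fun z => wt N.card z * φ z), Finset.sum_div]
  apply Finset.sum_congr rfl
  intro z hz
  have hz' : z ≤ N.card := by simp at hz; omega
  rw [nsmul_eq_mul, Nat.cast_choose ℝ hz']
  unfold wt
  rw [Nat.factorial_succ]
  have : (N.card.factorial : ℝ) ≠ 0 := by positivity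
  have : (z.factorial : ℝ) ≠ 0 := by positivity
  have : ((N.card - z).factorial : ℝ) ≠ 0 := by positivity
  push_cast
  field_simp

lemma wt_sum {X : Type} [DecidableEq X] (N K : Finset X) (hd : Disjoint N K) (φ : ℕ → ℝ) :
    ∑ U ∈ (N ∪ K).powerset, wt (N ∪ K).card U.card * φ (U ∩ N).card =
      (∑ z ∈ Finset.range (N.card + 1), φ z) / (N.card + 1) := by
  induction K using Finset.induction_on with
  | empty =>
    rw [Finset.union_empty, ← wt_base]
    apply Finset.sum_congr rfl
    intro U hU
    rw [Finset.inter_eq_left.2 (Finset.mem_powerset.1 hU)]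
  | insert x K hx ih =>
    rw [Finset.disjoint_insert_right] at hd
    rw [← ih hd.2, Finset.union_insert]
    have hxn : x ∉ N ∪ K := by simp [hx, hd.1]
    rw [Finset.sum_powerset_insert hxn, ← Finset.sum_add_distrib, Finset.card_insert_of_notMem hxn]
    apply Finset.sum_congr rfl
    intro U hU
    rw [Finset.mem_powerset] at hU
    have hxU : x ∉ U := fun h => hxn (hU h)
    rw [Finset.card_insert_of_notMem hxU, Finset.insert_inter_of_notMem hd.1, ← add_mul,
      wt_split _ _ (Finset.card_le_card hU)]

lemma wt_univ {X : Type} [Fintype X] [DecidableEq X] (N : Finset X) (φ : ℕ → ℝ) :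
    ∑ U : Finset X, wt (Fintype.card X) U.card * φ (U ∩ N).card =
      (∑ z ∈ Finset.range (N.card + 1), φ z) / (N.card + 1) := by
  have := wt_sum N Nᶜ disjoint_compl_right φ
  rw [Finset.union_compl, Finset.powerset_univ] at this
  exact this

lemma wt_one {X : Type} [Fintype X] [DecidableEq X] :
    ∑ U : Finset X, wt (Fintype.card X) U.card = 1 := by
  have := wt_univ (∅ : Finset X) (fun _ => 1)
  simpa using this

lemma wt_mean {X : Type} [Fintype X] [DecidableEq X] (N : Finset X) :
    ∑ U : Finset X, wt (Fintype.card X) U.card * ((U ∩ N).card : ℝ) = (N.card : ℝ) / 2 := by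
  rw [wt_univ N (fun z => (z : ℝ))]
  have h : ∀ n : ℕ, ∑ z ∈ Finset.range (n + 1), (z : ℝ) = n * (n + 1) / 2 := by
    intro n
    induction n with
    | zero => simp
    | succ n ih => rw [Finset.sum_range_succ, ih]; push_cast; ring
  rw [h]; field_simp

lemma wt_dvd {X : Type} [Fintype X] [DecidableEq X] (N : Finset X) (g : ℕ) (hg : 1 ≤ g) :
    ∑ U : Finset X, wt (Fintype.card X) U.card *
      (if g ∣ (U ∩ N).card then ((U ∩ N).card : ℝ) else 0) ≤ (N.card : ℝ) / g := by
  rw [wt_univ N (fun z => if g ∣ z then (z : ℝ) else 0)]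
  have hg' : (0 : ℝ) < g := by exact_mod_cast hg
  rw [div_le_div_iff₀ (by positivity) hg', ← Finset.sum_filter]
  have h1 : ∑ z ∈ (Finset.range (N.card + 1)).filter (fun z => g ∣ z), (z : ℝ) ≤
      N.card * (N.card / g : ℕ) := by
    have e : ∑ z ∈ (Finset.range (N.card + 1)).filter (fun z => g ∣ z), (z : ℝ) =
        ∑ z ∈ (Finset.Ioc 0 N.card).filter (fun z => g ∣ z), (z : ℝ) := by
      symm
      apply Finset.sum_subset
      · intro z; simp; omega
      · intro z; simp; intro h1 h2 h3
        by_contra h0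
        exact h3 (by omega) h1 h2
    rw [e]
    calc _ ≤ ∑ z ∈ (Finset.Ioc 0 N.card).filter (fun z => g ∣ z), (N.card : ℝ) := by
          apply Finset.sum_le_sum
          intro z hz
          simp at hz
          exact_mod_cast hz.1.2
      _ = _ := by
          rw [Finset.sum_const, Nat.Ioc_filter_dvd_card_eq_div, nsmul_eq_mul, mul_comm]
  have h2 : ((N.card / g : ℕ) : ℝ) * g ≤ N.card := by exact_mod_cast Nat.div_mul_le_self _ _
  have h3 : (0 : ℝ) ≤ N.card := by positivity
  calc _ ≤ (N.card * (N.card / g : ℕ) : ℝ) * g := mul_le_mul_of_nonneg_right h1 hg'.le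
    _ = N.card * ((N.card / g : ℕ) * g) := by ring
    _ ≤ N.card * N.card := mul_le_mul_of_nonneg_left h2 h3
    _ ≤ _ := by nlinarith

/-- harmonic-like sum -/
noncomputable def HH (B : ℕ) : ℝ := ∑ g ∈ Finset.Icc 1 B, (1 : ℝ) / g

lemma HH_nonneg (B : ℕ) : 0 ≤ HH B := by unfold HH; positivity

lemma sum_dvd_le (B δ : ℕ) (hδ : 1 ≤ δ) :
    ∑ g ∈ (Finset.Icc 1 B).filter (fun g => δ ∣ g), (1 : ℝ) / g ≤ HH B / δ := by
  unfold HH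
  rw [Finset.sum_div]
  have : (Finset.Icc 1 B).filter (fun g => δ ∣ g) ⊆ (Finset.Icc 1 B).image (fun i => δ * i) := by
    intro g hg
    simp only [Finset.mem_filter, Finset.mem_Icc] at hg
    obtain ⟨⟨h1, h2⟩, i, rfl⟩ := hg
    refine Finset.mem_image.2 ⟨i, ?_, rfl⟩
    rw [Finset.mem_Icc]
    constructor
    · by_contra h; have : i = 0 := by omega
      subst this; simp at h1
    · exact (Nat.le_mul_of_pos_left _ hδ).trans h2
  calc _ ≤ ∑ g ∈ (Finset.Icc 1 B).image (fun i => δ * i), (1 : ℝ) / g :=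
        Finset.sum_le_sum_of_subset_of_nonneg this (fun _ _ _ => by positivity)
    _ = ∑ i ∈ Finset.Icc 1 B, (1 : ℝ) / ((δ * i : ℕ) : ℝ) := by
        rw [Finset.sum_image]
        intro i _ j _ h
        exact Nat.eq_of_mul_eq_mul_left hδ h
    _ = _ := by
        apply Finset.sum_congr rfl
        intro i _
        push_cast
        rw [div_div, mul_comm]

lemma sum_lcm_le (B : ℕ) :
    ∑ g ∈ Finset.Icc 1 B, ∑ h ∈ Finset.Icc 1 B, (1 : ℝ) / (Nat.lcm g h) ≤ HH B ^ 3 := by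
  have h1 : ∀ g ∈ Finset.Icc 1 B, ∀ h ∈ Finset.Icc 1 B, (1 : ℝ) / (Nat.lcm g h) ≤
      ∑ δ ∈ Finset.Icc 1 B, if δ ∣ g ∧ δ ∣ h then (δ : ℝ) * (1 / g) * (1 / h) else 0 := by
    intro g hg h hh
    rw [Finset.mem_Icc] at hg hh
    have hm : Nat.gcd g h ∈ Finset.Icc 1 B := by
      rw [Finset.mem_Icc]
      exact ⟨Nat.gcd_pos_of_pos_left _ hg.1, (Nat.gcd_le_left _ hg.1).trans hg.2⟩
    have h2 := Finset.single_le_sum (f := fun δ : ℕ => if δ ∣ g ∧ δ ∣ h then (δ : ℝ) * (1 / g) * (1 / h) else 0)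
      (fun δ _ => by split_ifs <;> positivity) hm
    refine le_trans (le_of_eq ?_) h2
    rw [if_pos ⟨Nat.gcd_dvd_left _ _, Nat.gcd_dvd_right _ _⟩]
    have e : (Nat.gcd g h : ℝ) * (Nat.lcm g h) = g * h := by exact_mod_cast Nat.gcd_mul_lcm g h
    have p1 : (0 : ℝ) < g := by exact_mod_cast hg.1
    have p2 : (0 : ℝ) < h := by exact_mod_cast hh.1
    have p3 : (0 : ℝ) < Nat.lcm g h := by exact_mod_cast Nat.lcm_pos hg.1 hh.1
    field_simp
    linarith
  calc _ ≤ ∑ g ∈ Finset.Icc 1 B, ∑ h ∈ Finset.Icc 1 B,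
      ∑ δ ∈ Finset.Icc 1 B, if δ ∣ g ∧ δ ∣ h then (δ : ℝ) * (1 / g) * (1 / h) else 0 :=
        Finset.sum_le_sum fun g hg => Finset.sum_le_sum fun h hh => h1 g hg h hh
    _ = ∑ δ ∈ Finset.Icc 1 B, (δ : ℝ) *
        (∑ g ∈ (Finset.Icc 1 B).filter (fun g => δ ∣ g), (1 : ℝ) / g) ^ 2 := by
        rw [Finset.sum_congr rfl (fun g _ => Finset.sum_comm), Finset.sum_comm]
        apply Finset.sum_congr rfl
        intro δ _
        rw [pow_two, Finset.sum_filter, Finset.sum_mul_sum, Finset.mul_sum]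
        apply Finset.sum_congr rfl
        intro g _
        rw [Finset.mul_sum]
        apply Finset.sum_congr rfl
        intro h _
        by_cases a : δ ∣ g <;> by_cases b : δ ∣ h <;> simp [a, b, mul_assoc]
    _ ≤ ∑ δ ∈ Finset.Icc 1 B, (1 / (δ : ℝ)) * HH B ^ 2 := by
        apply Finset.sum_le_sum
        intro δ hδ
        have hδ1 := (Finset.mem_Icc.1 hδ).1
        have p1 : (0 : ℝ) < δ := by exact_mod_cast hδ1
        have := sum_dvd_le B δ hδ1
        calc _ ≤ (δ : ℝ) * (HH B / δ) ^ 2 := by gcongr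
          _ = _ := by field_simp
    _ = _ := by rw [← Finset.sum_mul]; unfold HH; ring

lemma HH_le (B : ℕ) : HH B ≤ Nat.log 2 B + 1 := by
  have h : ∀ k : ℕ, HH (2 ^ k - 1) ≤ k := by
    intro k
    induction k with
    | zero => simp [HH]
    | succ k ih =>
      have e : Finset.Icc 1 (2 ^ (k + 1) - 1) = Finset.Icc 1 (2 ^ k - 1) ∪ Finset.Ico (2 ^ k) (2 ^ (k + 1)) := by
        have : 1 ≤ 2 ^ k := Nat.one_le_two_pow
        have : 2 ^ (k + 1) = 2 * 2 ^ k := by ring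
        ext z; simp only [Finset.mem_Icc, Finset.mem_union, Finset.mem_Ico]; omega
      have h2 : HH (2 ^ (k + 1) - 1) ≤ HH (2 ^ k - 1) + ∑ g ∈ Finset.Ico ((2 : ℕ) ^ k) (2 ^ (k + 1)), (1 : ℝ) / g := by
        unfold HH
        rw [e]
        rw [Finset.sum_union]
        rw [Finset.disjoint_left]; intro z; simp; intro _ h1; omega
      have h3 : ∑ g ∈ Finset.Ico ((2 : ℕ) ^ k) (2 ^ (k + 1)), (1 : ℝ) / g ≤
          ∑ g ∈ Finset.Ico ((2 : ℕ) ^ k) (2 ^ (k + 1)), (1 : ℝ) / 2 ^ k := by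
        apply Finset.sum_le_sum
        intro g hg
        rw [Finset.mem_Ico] at hg
        have : (2 : ℝ) ^ k ≤ g := by exact_mod_cast hg.1
        gcongr
      have h4 : ∑ g ∈ Finset.Ico ((2 : ℕ) ^ k) (2 ^ (k + 1)), (1 : ℝ) / 2 ^ k = 1 := by
        rw [Finset.sum_const, Nat.card_Ico]
        have : 2 ^ (k + 1) - 2 ^ k = 2 ^ k := by rw [pow_succ]; omega
        rw [this]; simp
      push_cast; linarith
  have h1 := h (Nat.log 2 B + 1)
  have h2 : B ≤ 2 ^ (Nat.log 2 B + 1) - 1 := by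
    have := Nat.lt_pow_succ_log_self (b := 2) (by norm_num) B
    simp only [Nat.succ_eq_add_one] at this
    omega
  have h3 : HH B ≤ HH (2 ^ (Nat.log 2 B + 1) - 1) := by
    unfold HH
    exact Finset.sum_le_sum_of_subset_of_nonneg (Finset.Icc_subset_Icc_right h2) (fun _ _ _ => by positivity)
  push_cast at h1
  linarith

/-- the multiplication table of a bipartite graph -/
def MM {X Y : Type} [Fintype X] [Fintype Y] [DecidableEq X] [DecidableEq Y]
    (E : Finset (X × Y)) : Finset ℕ :=
  ((Finset.univ.powerset ×ˢ Finset.univ.powerset).image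
          (fun p : Finset X × Finset Y =>
            (E.filter (fun e => e.1 ∈ p.1 ∧ e.2 ∈ p.2)).card))

lemma mem_MM {X Y : Type} [Fintype X] [Fintype Y] [DecidableEq X] [DecidableEq Y]
    (E : Finset (X × Y)) (n : ℕ) : n ∈ MM E ↔ ∃ (U : Finset X) (W : Finset Y),
      (E.filter (fun e => e.1 ∈ U ∧ e.2 ∈ W)).card = n := by
  simp [MM]

/-- neighbourhood of `y` -/
def NN {X Y : Type} [Fintype X] [DecidableEq X] [DecidableEq Y]
    (E : Finset (X × Y)) (y : Y) : Finset X := Finset.univ.filter (fun x => (x, y) ∈ E)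

lemma card_filter_eq {X Y : Type} [Fintype X] [Fintype Y] [DecidableEq X] [DecidableEq Y]
    (E : Finset (X × Y)) (U : Finset X) (W : Finset Y) :
    (E.filter (fun e => e.1 ∈ U ∧ e.2 ∈ W)).card = ∑ y ∈ W, (U ∩ NN E y).card := by
  rw [Finset.card_eq_sum_card_fiberwise (f := fun e => e.2) (t := W)]
  · apply Finset.sum_congr rfl
    intro y hy
    symm
    apply Finset.card_bij (fun x _ => (x, y))
    · intro x hx
      simp [NN] at hx
      simp [hx, hy]
    · intro x _ x' _ h
      simpa using h
    · rintro ⟨x, y'⟩ h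
      simp at h
      obtain ⟨⟨h1, h2, h3⟩, rfl⟩ := h
      exact ⟨x, by simp [NN, h1, h2], rfl⟩
  · intro e he
    simp at he
    exact he.2.2

lemma card_eq_sum {X Y : Type} [Fintype X] [Fintype Y] [DecidableEq X] [DecidableEq Y]
    (E : Finset (X × Y)) : E.card = ∑ y, (NN E y).card := by
  have := card_filter_eq E Finset.univ Finset.univ
  simpa using this

lemma mem_MM_le {X Y : Type} [Fintype X] [Fintype Y] [DecidableEq X] [DecidableEq Y]
    (E : Finset (X × Y)) (n : ℕ) (h : n ∈ MM E) : n ≤ E.card := by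
  rw [mem_MM] at h
  obtain ⟨U, W, rfl⟩ := h
  exact Finset.card_filter_le _ _

/-- collision counting -/
lemma collision (M Γ : Finset ℕ) (B e : ℕ) (T : ℕ → Finset ℕ) (hBe : B * B ≤ e)
    (hΓ : Γ ⊆ Finset.Icc 1 B) (hT : ∀ g ∈ Γ, T g ⊆ M) (hM : ∀ n ∈ M, n ≤ e)
    (hd : ∀ g ∈ Γ, ∀ n ∈ T g, g ∣ n) :
    (∑ g ∈ Γ, ((T g).card : ℝ)) ^ 2 ≤ M.card * (2 * e * HH B ^ 3) := by
  have h1 : ∀ g ∈ Γ, ((T g).card : ℝ) = ∑ n ∈ M, if n ∈ T g then (1 : ℝ) else 0 := by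
    intro g hg
    rw [← Finset.sum_filter, Finset.filter_mem_eq_inter, Finset.inter_eq_right.2 (hT g hg)]
    simp
  rw [Finset.sum_congr rfl h1, Finset.sum_comm]
  refine (sq_sum_le_card_mul_sum_sq).trans ?_
  apply mul_le_mul_of_nonneg_left _ (by positivity)
  have h2 : ∑ n ∈ M, (∑ g ∈ Γ, if n ∈ T g then (1 : ℝ) else 0) ^ 2 =
      ∑ g ∈ Γ, ∑ h ∈ Γ, ∑ n ∈ M, if n ∈ T g ∧ n ∈ T h then (1 : ℝ) else 0 := by
    rw [Finset.sum_congr rfl (fun g _ => Finset.sum_comm), Finset.sum_comm]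
    apply Finset.sum_congr rfl
    intro n _
    rw [pow_two, Finset.sum_mul_sum]
    apply Finset.sum_congr rfl
    intro g _
    apply Finset.sum_congr rfl
    intro h _
    by_cases a : n ∈ T g <;> by_cases b : n ∈ T h <;> simp [a, b]
  rw [h2]
  have h3 : ∀ g ∈ Γ, ∀ h ∈ Γ, (∑ n ∈ M, if n ∈ T g ∧ n ∈ T h then (1 : ℝ) else 0) ≤
      2 * e * (1 / (Nat.lcm g h : ℝ)) := by
    intro g hg h hh
    have hg' := Finset.mem_Icc.1 (hΓ hg)
    have hh' := Finset.mem_Icc.1 (hΓ hh)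
    rw [← Finset.sum_filter, Finset.sum_const, nsmul_eq_mul, mul_one]
    have hsub : M.filter (fun n => n ∈ T g ∧ n ∈ T h) ⊆
        insert 0 ((Finset.Ioc 0 e).filter (fun n => Nat.lcm g h ∣ n)) := by
      intro n hn
      simp only [Finset.mem_filter] at hn
      simp only [Finset.mem_insert, Finset.mem_filter, Finset.mem_Ioc]
      have a1 := hM n hn.1
      have a2 := Nat.lcm_dvd (hd g hg n hn.2.1) (hd h hh n hn.2.2)
      by_cases h0 : n = 0
      · exact Or.inl h0
      · exact Or.inr ⟨⟨by omega, a1⟩, a2⟩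
    have hc := (Finset.card_le_card hsub).trans (Finset.card_insert_le _ _)
    rw [Nat.Ioc_filter_dvd_card_eq_div] at hc
    have hl : Nat.lcm g h ≤ e := by
      have : Nat.lcm g h ≤ g * h := Nat.le_of_dvd (Nat.mul_pos hg'.1 hh'.1) (Nat.lcm_dvd_mul g h)
      exact this.trans ((Nat.mul_le_mul hg'.2 hh'.2).trans hBe)
    have hlp : 0 < Nat.lcm g h := Nat.lcm_pos hg'.1 hh'.1
    have hlp' : (0 : ℝ) < Nat.lcm g h := by exact_mod_cast hlp
    have h4 : ((M.filter (fun n => n ∈ T g ∧ n ∈ T h)).card : ℝ) ≤ ((e / Nat.lcm g h : ℕ) : ℝ) + 1 := by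
      exact_mod_cast hc
    have h5 : ((e / Nat.lcm g h : ℕ) : ℝ) ≤ (e : ℝ) / Nat.lcm g h := Nat.cast_div_le
    have h6 : (1 : ℝ) ≤ (e : ℝ) / Nat.lcm g h := by
      rw [le_div_iff₀ hlp', one_mul]; exact_mod_cast hl
    have h7 : 2 * (e : ℝ) * (1 / (Nat.lcm g h : ℝ)) = 2 * ((e : ℝ) / Nat.lcm g h) := by ring
    rw [h7]; linarith
  calc _ ≤ ∑ g ∈ Γ, ∑ h ∈ Γ, 2 * (e : ℝ) * (1 / (Nat.lcm g h : ℝ)) :=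
        Finset.sum_le_sum fun g hg => Finset.sum_le_sum fun h hh => h3 g hg h hh
    _ ≤ ∑ g ∈ Finset.Icc 1 B, ∑ h ∈ Finset.Icc 1 B, 2 * (e : ℝ) * (1 / (Nat.lcm g h : ℝ)) := by
        refine (Finset.sum_le_sum fun g _ => Finset.sum_le_sum_of_subset_of_nonneg hΓ
          (fun _ _ _ => by positivity)).trans ?_
        exact Finset.sum_le_sum_of_subset_of_nonneg hΓ (fun _ _ _ => by positivity)
    _ = 2 * e * ∑ g ∈ Finset.Icc 1 B, ∑ h ∈ Finset.Icc 1 B, (1 / (Nat.lcm g h : ℝ)) := by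
        simp only [Finset.mul_sum]
    _ ≤ _ := mul_le_mul_of_nonneg_left (sum_lcm_le B) (by positivity)

lemma core {X Y : Type} [Fintype X] [Fintype Y] [DecidableEq X] [DecidableEq Y]
    (E : Finset (X × Y)) (B : ℕ) (hB1 : 1 ≤ B) (hdeg : ∀ y, (NN E y).card ≤ B)
    (he : 16 * (B * (Nat.log 2 B + 1)) ^ 2 ≤ E.card) :
    (3 / 16 : ℝ) ^ 4 * E.card ≤ 2 * (Nat.log 2 B + 1) ^ 3 * (MM E).card := by
  classical
  set a : Finset X → Y → ℕ := fun U y => (U ∩ NN E y).card with ha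
  set L := Nat.log 2 B + 1 with hL
  set e := E.card with hedef
  have hL1 : 1 ≤ L := by omega
  have ha_le : ∀ U y, a U y ≤ (NN E y).card := fun U y => Finset.card_le_card Finset.inter_subset_right
  choose g hg1 R hR hcard hdv T hT hTd hTsum using
    fun U => key_lemma (a U) B Finset.univ (fun y _ => (ha_le U y).trans (hdeg y))
  have hepos : 0 < e := by
    have : 0 < 16 * (B * L) ^ 2 := by positivity
    omega
  have hlost : ∀ U, 16 * ∑ y, a U y ≤ 16 * ∑ y ∈ R U, a U y + e := by
    intro U
    have h1 : ∑ y ∈ Finset.univ \ R U, a U y ≤ (Finset.univ \ R U).card * B := by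
      rw [← smul_eq_mul]
      exact Finset.sum_le_card_nsmul _ _ _ (fun y _ => (ha_le U y).trans (hdeg y))
    have h2 : (Finset.univ \ R U).card * B ≤ (L * (B * L)) * B := Nat.mul_le_mul_right _ (hcard U)
    have h3 : (L * (B * L)) * B = (B * L) ^ 2 := by ring
    have h4 := Finset.sum_sdiff (f := a U) (hR U)
    omega
  set Good : Finset (Finset X) := Finset.univ.filter (fun U => e ≤ 4 * ∑ y, a U y) with hGood
  set Γ := Good.image g with hΓdef
  have hgoodR : ∀ U ∈ Good, 3 * e ≤ 16 * ∑ y ∈ R U, a U y := by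
    intro U hU
    simp only [hGood, Finset.mem_filter, Finset.mem_univ, true_and] at hU
    have := hlost U
    omega
  have hΓ : Γ ⊆ Finset.Icc 1 B := by
    intro γ hγ
    obtain ⟨U, hU, rfl⟩ := Finset.mem_image.1 hγ
    rw [Finset.mem_Icc]
    refine ⟨hg1 U, ?_⟩
    have h1 := hgoodR U hU
    have h2 : ∑ y ∈ R U, a U y ≠ 0 := by omega
    obtain ⟨y, hy, hy0⟩ := Finset.exists_ne_zero_of_sum_ne_zero h2
    exact (Nat.le_of_dvd (Nat.pos_of_ne_zero hy0) (hdv U y hy)).trans ((ha_le U y).trans (hdeg y))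
  -- the harmonic sum over Γ is large
  set w : Finset X → ℝ := fun U => wt (Fintype.card X) U.card with hw
  have hw0 : ∀ U, 0 ≤ w U := fun U => wt_nonneg _ _
  have hmean : ∑ U, w U * (∑ y, (a U y : ℝ)) = (e : ℝ) / 2 := by
    simp only [Finset.mul_sum]
    rw [Finset.sum_comm]
    rw [Finset.sum_congr rfl (fun y _ => wt_mean (NN E y)), ← Finset.sum_div]
    rw [hedef, card_eq_sum E]; push_cast; rfl
  have hlow : ∀ U, (∑ y, (a U y : ℝ)) - 5 / 16 * e ≤
      ∑ y, ∑ γ ∈ Γ, if γ ∣ a U y then (a U y : ℝ) else 0 := by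
    intro U
    have hnn : 0 ≤ ∑ y, ∑ γ ∈ Γ, if γ ∣ a U y then (a U y : ℝ) else 0 :=
      Finset.sum_nonneg fun y _ => Finset.sum_nonneg fun γ _ => by split_ifs <;> positivity
    by_cases hU : U ∈ Good
    · have h1 : (16 : ℝ) * ∑ y, (a U y : ℝ) ≤ 16 * ∑ y ∈ R U, (a U y : ℝ) + e := by
        exact_mod_cast hlost U
      have h2 : ∑ y ∈ R U, (a U y : ℝ) ≤ ∑ y, ∑ γ ∈ Γ, if γ ∣ a U y then (a U y : ℝ) else 0 := by
        calc ∑ y ∈ R U, (a U y : ℝ) ≤ ∑ y ∈ R U, ∑ γ ∈ Γ, if γ ∣ a U y then (a U y : ℝ) else 0 := by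
              apply Finset.sum_le_sum
              intro y hy
              have := Finset.single_le_sum (f := fun γ : ℕ => if γ ∣ a U y then (a U y : ℝ) else 0)
                (s := Γ) (fun γ _ => by split_ifs <;> positivity) (Finset.mem_image_of_mem g hU)
              simpa [hdv U y hy] using this
          _ ≤ _ := Finset.sum_le_sum_of_subset_of_nonneg (hR U) (fun y _ _ =>
              Finset.sum_nonneg fun γ _ => by split_ifs <;> positivity)
      have : (0 : ℝ) ≤ e := by positivity
      linarith
    · simp only [hGood, Finset.mem_filter, Finset.mem_univ, true_and, not_le] at hU
      have h1 : (4 : ℝ) * ∑ y, (a U y : ℝ) < e := by exact_mod_cast hU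
      linarith
  have hsum : (3 / 16 : ℝ) ≤ ∑ γ ∈ Γ, (1 : ℝ) / γ := by
    have h1 : ∑ U, w U * ((∑ y, (a U y : ℝ)) - 5 / 16 * e) ≤
        ∑ U, w U * (∑ y, ∑ γ ∈ Γ, if γ ∣ a U y then (a U y : ℝ) else 0) :=
      Finset.sum_le_sum fun U _ => mul_le_mul_of_nonneg_left (hlow U) (hw0 U)
    have h2 : ∑ U, w U * ((∑ y, (a U y : ℝ)) - 5 / 16 * e) = 3 / 16 * e := by
      simp only [mul_sub]
      rw [Finset.sum_sub_distrib, hmean, ← Finset.sum_mul, wt_one]; ring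
    have h3 : ∑ U, w U * (∑ y, ∑ γ ∈ Γ, if γ ∣ a U y then (a U y : ℝ) else 0) ≤
        e * ∑ γ ∈ Γ, (1 : ℝ) / γ := by
      simp only [Finset.mul_sum]
      rw [Finset.sum_comm, Finset.sum_congr rfl (fun y _ => Finset.sum_comm)]
      calc _ ≤ ∑ y, ∑ γ ∈ Γ, ((NN E y).card : ℝ) / γ :=
            Finset.sum_le_sum fun y _ => Finset.sum_le_sum fun γ hγ =>
              wt_dvd (NN E y) γ (Finset.mem_Icc.1 (hΓ hγ)).1
        _ = _ := by
            rw [Finset.sum_comm]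
            apply Finset.sum_congr rfl
            intro γ _
            rw [← Finset.sum_div, hedef, card_eq_sum E]; push_cast; ring
    have he' : (0 : ℝ) < e := by exact_mod_cast hepos
    rw [h2] at h1
    have h4 := h1.trans h3
    rw [mul_comm] at h4
    exact le_of_mul_le_mul_left h4 he'
  -- choose representatives
  have hrep : ∀ γ : ℕ, ∃ U, γ ∈ Γ → U ∈ Good ∧ g U = γ := by
    intro γ
    by_cases h : γ ∈ Γ
    · obtain ⟨U, hU, h2⟩ := Finset.mem_image.1 h
      exact ⟨U, fun _ => ⟨hU, h2⟩⟩
    · exact ⟨∅, fun h' => absurd h' h⟩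
  choose V hV using hrep
  have hTM : ∀ U, T U ⊆ MM E := by
    intro U n hn
    obtain ⟨W, _, rfl⟩ := Finset.mem_image.1 (hT U hn)
    rw [mem_MM]
    exact ⟨U, W, card_filter_eq E U W⟩
  have hBL : B * B ≤ e := by
    have : B * B ≤ (B * L) ^ 2 := by
      rw [pow_two]
      exact Nat.mul_le_mul (Nat.le_mul_of_pos_right _ hL1) (Nat.le_mul_of_pos_right _ hL1)
    omega
  have hcol := collision (MM E) Γ B e (fun γ => T (V γ)) hBL hΓ (fun γ _ => hTM _)
    (fun n hn => mem_MM_le E n hn) (fun γ hγ n hn => by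
      have := hTd (V γ) n hn
      rwa [(hV γ hγ).2] at this)
  have hTl : (3 / 16 : ℝ) ^ 2 * e ≤ ∑ γ ∈ Γ, ((T (V γ)).card : ℝ) := by
    calc (3 / 16 : ℝ) ^ 2 * e ≤ (∑ γ ∈ Γ, (1 : ℝ) / γ) * (3 / 16 * e) := by
          have : (0 : ℝ) ≤ e := by positivity
          nlinarith
      _ = ∑ γ ∈ Γ, (1 : ℝ) / γ * (3 / 16 * e) := by rw [Finset.sum_mul]
      _ ≤ _ := by
          apply Finset.sum_le_sum
          intro γ hγ
          have hγ0 : (0 : ℝ) < γ := by exact_mod_cast (Finset.mem_Icc.1 (hΓ hγ)).1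
          have h1 := hgoodR (V γ) (hV γ hγ).1
          have h2 := hTsum (V γ)
          rw [(hV γ hγ).2] at h2
          have h3 : 3 * e ≤ 16 * (γ * (T (V γ)).card) := by omega
          have h4 : (3 : ℝ) * e ≤ 16 * (γ * (T (V γ)).card) := by exact_mod_cast h3
          rw [div_mul_eq_mul_div, div_le_iff₀ hγ0]
          linarith
  have he' : (0 : ℝ) < e := by exact_mod_cast hepos
  have hH : HH B ^ 3 ≤ (L : ℝ) ^ 3 := by
    have := HH_le B
    have h0 := HH_nonneg B
    rw [hL]; push_cast
    gcongr
  have h5 : ((3 / 16 : ℝ) ^ 2 * e) ^ 2 ≤ (MM E).card * (2 * e * (L : ℝ) ^ 3) := by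
    calc _ ≤ (∑ γ ∈ Γ, ((T (V γ)).card : ℝ)) ^ 2 := by gcongr
      _ ≤ _ := hcol
      _ ≤ _ := by gcongr
  have h6 : e * ((3 / 16 : ℝ) ^ 4 * e) ≤ e * (2 * (L : ℝ) ^ 3 * (MM E).card) := by
    calc _ = ((3 / 16 : ℝ) ^ 2 * e) ^ 2 := by ring
      _ ≤ _ := h5
      _ = _ := by ring
  have h7 := le_of_mul_le_mul_left h6 he'
  rw [hL] at h7
  push_cast at h7
  exact h7

lemma MM_filter {X Y : Type} [Fintype X] [Fintype Y] [DecidableEq X] [DecidableEq Y]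
    (E : Finset (X × Y)) (S : Finset X) : MM (E.filter (fun e => e.1 ∈ S)) ⊆ MM E := by
  intro n hn
  rw [mem_MM] at *
  obtain ⟨U, W, rfl⟩ := hn
  refine ⟨U ∩ S, W, ?_⟩
  rw [Finset.filter_filter]
  congr 1
  ext e
  simp only [Finset.mem_filter, Finset.mem_inter]
  tauto

lemma MM_swap {X Y : Type} [Fintype X] [Fintype Y] [DecidableEq X] [DecidableEq Y]
    (E : Finset (X × Y)) : MM (E.image Prod.swap) ⊆ MM E := by
  intro n hn
  rw [mem_MM] at *
  obtain ⟨W, U, rfl⟩ := hn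
  refine ⟨U, W, ?_⟩
  rw [Finset.filter_image, Finset.card_image_of_injective _ Prod.swap_injective]
  congr 1
  ext e
  simp only [Finset.mem_filter, Prod.fst_swap, Prod.snd_swap]
  tauto

lemma core' {X Y : Type} [Fintype X] [Fintype Y] [DecidableEq X] [DecidableEq Y]
    (E : Finset (X × Y)) (B l : ℕ) (hB1 : 1 ≤ B) (hdeg : ∀ y, (NN E y).card ≤ B)
    (hl : Nat.log 2 B + 1 ≤ l) (he : 16 * (B * l) ^ 2 ≤ E.card) :
    (3 / 16 : ℝ) ^ 4 * E.card ≤ 2 * (l : ℝ) ^ 3 * (MM E).card := by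
  have h1 : 16 * (B * (Nat.log 2 B + 1)) ^ 2 ≤ E.card := by
    refine le_trans ?_ he
    gcongr
  refine (core E B hB1 hdeg h1).trans ?_
  have : (Nat.log 2 B + 1 : ℝ) ≤ l := by exact_mod_cast hl
  gcongr

lemma reduce {X Y : Type} [Fintype X] [Fintype Y] [DecidableEq X] [DecidableEq Y]
    (E : Finset (X × Y)) (l q : ℕ) (hl : l = Nat.log 2 E.card + 1) (hq : 1 ≤ q)
    (hm : 8192 * l ^ 6 * q ^ 2 ≤ E.card) :
    (3 / 16 : ℝ) ^ 4 * (16 * l ^ 2 * q ^ 2) ≤ 2 * (l : ℝ) ^ 3 * (MM E).card := by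
  classical
  have hl1 : 1 ≤ l := by omega
  set B0 := 16 * l ^ 2 * q with hB0
  have hl26 : l ^ 2 ≤ l ^ 6 := Nat.pow_le_pow_right hl1 (by norm_num)
  have hqq : q ≤ q ^ 2 := by nlinarith
  have hmid : l ^ 2 * q ^ 2 ≤ l ^ 6 * q ^ 2 := Nat.mul_le_mul_right _ hl26
  have hmid2 : l ^ 2 * q ≤ l ^ 2 * q ^ 2 := Nat.mul_le_mul_left _ hqq
  have hmid3 : q ≤ l ^ 2 * q := Nat.le_mul_of_pos_left _ (by positivity)
  have hm' : 8192 * (l ^ 6 * q ^ 2) ≤ E.card := by rw [← mul_assoc]; exact hm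
  have hB0m : B0 ≤ E.card := by rw [hB0, mul_assoc]; omega
  have hqm : q ≤ E.card := by omega
  have hB01 : 1 ≤ B0 := by rw [hB0, mul_assoc]; omega
  have hlogB0 : Nat.log 2 B0 + 1 ≤ l := by
    rw [hl]; exact Nat.add_le_add_right (Nat.log_mono_right hB0m) 1
  have hlogq : Nat.log 2 q + 1 ≤ l := by
    rw [hl]; exact Nat.add_le_add_right (Nat.log_mono_right hqm) 1
  -- it suffices to find a good subgraph
  have fin : ∀ (e : ℕ) (M : Finset ℕ), M ⊆ MM E → 16 * (l ^ 2 * q ^ 2) ≤ e →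
      (3 / 16 : ℝ) ^ 4 * e ≤ 2 * (l : ℝ) ^ 3 * M.card →
      (3 / 16 : ℝ) ^ 4 * (16 * l ^ 2 * q ^ 2) ≤ 2 * (l : ℝ) ^ 3 * (MM E).card := by
    intro e M hM h1 h2
    have h3 : (16 : ℝ) * (l ^ 2 * q ^ 2) ≤ e := by exact_mod_cast h1
    have h4 : (M.card : ℝ) ≤ (MM E).card := by exact_mod_cast Finset.card_le_card hM
    calc (3 / 16 : ℝ) ^ 4 * (16 * l ^ 2 * q ^ 2) = (3 / 16 : ℝ) ^ 4 * (16 * (l ^ 2 * q ^ 2)) := by ring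
      _ ≤ (3 / 16 : ℝ) ^ 4 * e := by gcongr
      _ ≤ _ := h2
      _ ≤ _ := by gcongr
  set dX : X → ℕ := fun x => (E.filter (fun e => e.1 = x)).card with hdX
  set Xl : Finset X := Finset.univ.filter (fun x => dX x ≤ B0) with hXl
  have hsplit : (E.filter (fun e => e.1 ∈ Xl)).card + (E.filter (fun e => e.1 ∈ Xlᶜ)).card = E.card := by
    have := Finset.card_filter_add_card_filter_not (s := E) (fun e => e.1 ∈ Xl)
    simpa using this
  have hNN : ∀ (S : Finset X) (y : Y), (NN (E.filter (fun e => e.1 ∈ S)) y).card ≤ S.card := by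
    intro S y
    apply Finset.card_le_card
    intro x hx
    simp [NN] at hx
    exact hx.2
  by_cases hcase : E.card ≤ 2 * (E.filter (fun e => e.1 ∈ Xl)).card
  · -- low degree case, swap sides
    set E1 := E.filter (fun e => e.1 ∈ Xl) with hE1
    have hc : (E1.image Prod.swap).card = E1.card :=
      Finset.card_image_of_injective _ Prod.swap_injective
    refine fin E1.card (MM (E1.image Prod.swap)) ((MM_swap E1).trans (MM_filter E Xl)) (by omega) ?_
    rw [← hc]
    apply core' (E1.image Prod.swap) B0 l hB01 _ hlogB0
    · rw [hc]
      have : 16 * (B0 * l) ^ 2 = 4096 * (l ^ 6 * q ^ 2) := by rw [hB0]; ring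
      omega
    · intro x
      by_cases hx : x ∈ Xl
      · have hx' : dX x ≤ B0 := by simpa [hXl] using hx
        refine le_trans ?_ hx'
        apply Finset.card_le_card_of_injOn (fun y => (x, y))
        · intro y hy
          simp [NN, hE1] at hy
          simp [hy]
        · intro y _ y' _ h
          simpa using h
      · have : NN (E1.image Prod.swap) x = ∅ := by
          ext y
          simp [NN, hE1, hx]
        rw [this]; simp
  · by_cases hsz : Xlᶜ.card ≤ q
    · refine fin (E.filter (fun e => e.1 ∈ Xlᶜ)).card _ (MM_filter E Xlᶜ) (by omega) ?_
      apply core' _ q l hq (fun y => (hNN _ y).trans hsz) hlogq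
      have : 16 * (q * l) ^ 2 = 16 * (l ^ 2 * q ^ 2) := by ring
      omega
    · obtain ⟨S, hS, hSc⟩ := Finset.exists_subset_card_eq (not_le.1 hsz).le
      have hlow : 16 * (l ^ 2 * q ^ 2) ≤ (E.filter (fun e => e.1 ∈ S)).card := by
        have e1 : (E.filter (fun e => e.1 ∈ S)).card = ∑ x ∈ S, dX x := by
          rw [Finset.card_eq_sum_card_fiberwise (f := fun e => e.1) (t := S)]
          · apply Finset.sum_congr rfl
            intro x hx
            rw [hdX, Finset.filter_filter]
            congr 1
            ext e
            simp only [Finset.mem_filter]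
            constructor
            · rintro ⟨h1, _, h2⟩; exact ⟨h1, h2⟩
            · rintro ⟨h1, h2⟩; exact ⟨h1, by rw [h2]; exact hx, h2⟩
          · intro e he
            simp at he
            exact he.2
        rw [e1]
        calc 16 * (l ^ 2 * q ^ 2) = S.card • B0 := by rw [hSc, hB0, smul_eq_mul]; ring
          _ ≤ _ := Finset.card_nsmul_le_sum _ _ _ (fun x hx => by
              have := hS hx
              simp [hXl] at this
              exact this.le)
      refine fin (E.filter (fun e => e.1 ∈ S)).card _ (MM_filter E S) hlow ?_
      apply core' _ q l hq (fun y => (hNN _ y).trans hSc.le) hlogq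
      have : 16 * (q * l) ^ 2 = 16 * (l ^ 2 * q ^ 2) := by ring
      omega

lemma main_nat {X Y : Type} [Fintype X] [Fintype Y] [DecidableEq X] [DecidableEq Y]
    (E : Finset (X × Y)) (l : ℕ) (hl : l = Nat.log 2 E.card + 1) :
    (1 / 10 ^ 7 : ℝ) * E.card ≤ (l : ℝ) ^ 12 * (MM E).card := by
  have hl1 : 1 ≤ l := by omega
  have hl1' : (1 : ℝ) ≤ l := by exact_mod_cast hl1
  have hD : 0 < 8192 * l ^ 6 := by positivity
  set q := Nat.sqrt (E.card / (8192 * l ^ 6)) with hq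
  have hup : E.card < 8192 * l ^ 6 * (q + 1) ^ 2 := by
    have h1 : E.card / (8192 * l ^ 6) < (q + 1) ^ 2 := Nat.lt_succ_sqrt' _
    rw [Nat.div_lt_iff_lt_mul hD] at h1
    rwa [mul_comm] at h1
  have hup' : (E.card : ℝ) < 8192 * l ^ 6 * (q + 1) ^ 2 := by exact_mod_cast hup
  rcases Nat.eq_zero_or_pos q with h0 | hpos
  · rw [h0] at hup'
    have hM : 0 < (MM E).card := Finset.card_pos.2 ⟨_, (mem_MM E _).2 ⟨∅, ∅, rfl⟩⟩
    have hM' : (1 : ℝ) ≤ (MM E).card := by exact_mod_cast hM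
    have h6 : (l : ℝ) ^ 6 ≤ l ^ 12 := pow_le_pow_right₀ hl1' (by norm_num)
    have h7 : (0 : ℝ) ≤ l ^ 6 := by positivity
    norm_num at hup'
    calc (1 / 10 ^ 7 : ℝ) * E.card ≤ l ^ 12 * 1 := by linarith
      _ ≤ _ := by gcongr
  · have hlow : 8192 * l ^ 6 * q ^ 2 ≤ E.card := by
      have h1 : q ^ 2 ≤ E.card / (8192 * l ^ 6) := Nat.sqrt_le' _
      calc _ ≤ 8192 * l ^ 6 * (E.card / (8192 * l ^ 6)) := Nat.mul_le_mul_left _ h1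
        _ ≤ _ := Nat.mul_div_le _ _
    have h := reduce E l q hl hpos hlow
    have hq1 : (1 : ℝ) ≤ q := by exact_mod_cast hpos
    have h2 : ((q : ℝ) + 1) ^ 2 ≤ 4 * q ^ 2 := by nlinarith
    have h3 : (E.card : ℝ) ≤ 32768 * l ^ 6 * q ^ 2 := by
      calc (E.card : ℝ) ≤ 8192 * l ^ 6 * (q + 1) ^ 2 := hup'.le
        _ ≤ 8192 * l ^ 6 * (4 * q ^ 2) := by gcongr
        _ = _ := by ring
    have h4 : (1 / 10 ^ 7 : ℝ) * E.card ≤ l ^ 7 * (MM E).card := by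
      have h5 : (l : ℝ) ^ 4 * ((3 / 16 : ℝ) ^ 4 * (16 * l ^ 2 * q ^ 2)) ≤
          l ^ 4 * (2 * (l : ℝ) ^ 3 * (MM E).card) := by gcongr
      have e1 : (l : ℝ) ^ 4 * ((3 / 16 : ℝ) ^ 4 * (16 * l ^ 2 * q ^ 2)) =
        (3 / 16 : ℝ) ^ 4 * 16 * (l ^ 6 * q ^ 2) := by ring
      have e2 : (l : ℝ) ^ 4 * (2 * (l : ℝ) ^ 3 * (MM E).card) = 2 * (l ^ 7 * (MM E).card) := by ring
      rw [e1, e2] at h5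
      have h8 : (0 : ℝ) ≤ l ^ 6 * q ^ 2 := by positivity
      norm_num at h5 ⊢
      nlinarith
    refine h4.trans ?_
    have : (l : ℝ) ^ 7 ≤ l ^ 12 := pow_le_pow_right₀ hl1' (by norm_num)
    gcongr

/-- Main theorem: every bipartite graph with `m` edges has multiplication table of size
at least `c m / (log m)^12`. A bipartite graph is modelled by its finite edge set
`E ⊆ X × Y`; induced subgraphs correspond to pairs of subsets of the two parts. -/
theorem stmt14 : ∃ c : ℝ, 0 < c ∧
    ∀ (X Y : Type) [Fintype X] [Fintype Y] [DecidableEq X] [DecidableEq Y]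
      (E : Finset (X × Y)) (m : ℕ), E.card = m →
      c * m / (Real.log m) ^ 12 ≤
        (((Finset.univ.powerset ×ˢ Finset.univ.powerset).image
          (fun p : Finset X × Finset Y =>
            (E.filter (fun e => e.1 ∈ p.1 ∧ e.2 ∈ p.2)).card)).card : ℝ) := by
  refine ⟨1 / 10 ^ 7 / 3 ^ 12, by positivity, ?_⟩
  intro X Y _ _ _ _ E m hm
  change _ ≤ ((MM E).card : ℝ)
  by_cases hm2 : m ≤ 1
  · have : Real.log m = 0 := by
      interval_cases m <;> simp
    rw [this]; simp
  · have hm2' : 2 ≤ m := by omega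
    have hmr : (2 : ℝ) ≤ m := by exact_mod_cast hm2'
    have hlog2 : Real.log 2 ≤ Real.log m := Real.log_le_log (by norm_num) hmr
    have hl2 := Real.log_two_gt_d9
    have hlogpos : 0 < Real.log m := by linarith
    have h := main_nat E (Nat.log 2 E.card + 1) rfl
    rw [hm] at h
    have hpow : ((2 : ℝ)) ^ (Nat.log 2 m) ≤ m := by
      exact_mod_cast Nat.pow_log_le_self 2 (by omega)
    have h1 : (Nat.log 2 m : ℝ) * Real.log 2 ≤ Real.log m := by
      rw [← Real.log_pow]
      exact Real.log_le_log (by positivity) hpow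
    have h2 : ((Nat.log 2 m + 1 : ℕ) : ℝ) ≤ 3 * Real.log m := by
      push_cast
      have : (0 : ℝ) ≤ Nat.log 2 m := by positivity
      nlinarith
    rw [div_le_iff₀ (by positivity)]
    have h3 : (1 / 10 ^ 7 : ℝ) * m ≤ (3 * Real.log m) ^ 12 * (MM E).card := by
      refine h.trans ?_
      gcongr
    rw [mul_pow] at h3
    have e : (1 / 10 ^ 7 / 3 ^ 12 : ℝ) * m = ((1 / 10 ^ 7 : ℝ) * m) / 3 ^ 12 := by ring
    rw [e, div_le_iff₀ (by positivity)]
    linarith
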